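/- Let T and T′ be pretriangulated categories admitting arbitrary (small) coproducts, let F : T → T′ and G : T′ → T be an adjoint pair of triangulated functors (F left adjoint to G, with the adjunction compatible with the shifts). Suppose that S is a small weak generator of T, that F(S) is a small weak generator of T′, and that the unit morphism S → G(F(S)) of the adjunction is an isomorphism. Then the unit A → G(F(A)) and the counit F(G(B)) → B of the adjunction are isomorphisms for all objects A of T and B of T′; that is, F and G form an adjoint equivalence of categories. -/

import Mathlib

/-!
STATEMENT 5: Let `T`, `T′` be pretriangulated categories with arbitrary coproducts,
`F : T ⥤ T′` and `G : T′ ⥤ T` an adjoint pair of triangulated functors (`F ⊣ G`, the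
adjunction compatible with the shifts).  Suppose `S` is a small weak generator of `T`,
`F S` is a small weak generator of `T′`, and the unit `S ⟶ G (F S)` is an isomorphism.
Then the unit and the counit of the adjunction are isomorphisms on every object, i.e. `F`
and `G` form an adjoint equivalence.
-/

open CategoryTheory Category Limits Pretriangulated

universe v u

namespace Paper

variable {C : Type u} [Category.{v} C]

/-- The canonical map `⊕ᵢ Hom(G, Aᵢ) →+ Hom(G, ∐ᵢ Aᵢ)`. -/
noncomputable def coproductComparison [Preadditive C] (G : C) {ι : Type v} (A : ι → C)
    [HasCoproduct A] : DirectSum ι (fun i => G ⟶ A i) →+ (G ⟶ ∐ A) :=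
  letI := Classical.decEq ι
  DirectSum.toAddMonoid fun i =>
    AddMonoidHom.mk' (fun g => g ≫ Sigma.ι A i) fun _ _ => Preadditive.add_comp _ _ _ _ _ _

/-- An object `G` is small if for every family of objects admitting a coproduct, the
canonical map `⊕ᵢ Hom(G, Aᵢ) → Hom(G, ∐ᵢ Aᵢ)` is an isomorphism (bijective). -/
def IsSmallObject [Preadditive C] (G : C) : Prop :=
  ∀ ⦃ι : Type v⦄ (A : ι → C) [HasCoproduct A], Function.Bijective (coproductComparison G A)

/-- An object `G` is a weak generator if a map `f : X ⟶ Y` is an isomorphism exactly when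
`Hom(G⟦n⟧, X) → Hom(G⟦n⟧, Y)` is bijective for all integers `n`. -/
def IsWeakGenerator [HasShift C ℤ] (G : C) : Prop :=
  ∀ ⦃X Y : C⦄ (f : X ⟶ Y),
    IsIso f ↔ ∀ n : ℤ, Function.Bijective fun g : G⟦n⟧ ⟶ X => g ≫ f

end Paper

open Paper

namespace Paper

section Small

variable {C : Type u} [Category.{v} C] [Preadditive C]

/-- Finite-sum form of smallness. -/
def Sm [HasCoproducts.{v} C] (G : C) : Prop :=
  ∀ ⦃ι : Type v⦄ (A : ι → C) (g : G ⟶ ∐ A),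
    ∃ (s : Finset ι) (a : ∀ i, G ⟶ A i), g = ∑ i ∈ s, a i ≫ Sigma.ι A i

variable [HasCoproducts.{v} C]

lemma IsSmallObject.sm {G : C} (h : IsSmallObject G) : Sm G := by
  classical
  intro ι A g
  obtain ⟨x, rfl⟩ := (h A).2 g
  refine ⟨DFinsupp.support x, fun i => x i, ?_⟩
  conv_lhs => rw [← DirectSum.sum_support_of x]
  rw [map_sum]
  refine Finset.sum_congr rfl fun i _ => ?_
  rw [coproductComparison]
  convert DirectSum.toAddMonoid_of (β := fun i => G ⟶ A i) (fun i =>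
    AddMonoidHom.mk' (fun g => g ≫ Sigma.ι A i) fun _ _ => Preadditive.add_comp _ _ _ _ _ _) i (x i)
  rfl

lemma Sm.of_iso {G G' : C} (h : Sm G) (e : G ≅ G') : Sm G' := by
  intro ι A g
  obtain ⟨s, a, ha⟩ := h A (e.hom ≫ g)
  refine ⟨s, fun i => e.inv ≫ a i, ?_⟩
  rw [← cancel_epi e.hom, ha, Preadditive.comp_sum]
  simp

lemma Sm.eq_zero {G : C} (h : Sm G) {ι : Type v} [DecidableEq ι] (A : ι → C) (g : G ⟶ ∐ A)
    (hg : ∀ i, g ≫ Sigma.π A i = 0) : g = 0 := by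
  obtain ⟨s, a, rfl⟩ := h A g
  refine Finset.sum_eq_zero fun j hj => ?_
  have := hg j
  rw [Preadditive.sum_comp, Finset.sum_eq_single j] at this
  · have h2 : a j = 0 := by simpa using this
    rw [h2, zero_comp]
  · intro b _ hb
    rw [assoc, Sigma.ι_π_of_ne A hb, comp_zero]
  · intro h'; exact (h' hj).elim

lemma Sm.leftAdj {D : Type u} [Category.{v} D] [Preadditive D] [HasCoproducts.{v} D]
    {L : C ⥤ D} {R : D ⥤ C} (adj : L ⊣ R) [L.Additive]
    [∀ ι : Type v, PreservesColimitsOfShape (Discrete ι) R] {G : C} (h : Sm G) :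
    Sm (L.obj G) := by
  intro ι A g
  obtain ⟨s, a, ha⟩ := h (fun i => R.obj (A i))
    (adj.homEquiv _ _ g ≫ inv (sigmaComparison R A))
  refine ⟨s, fun i => (adj.homEquiv _ _).symm (a i), ?_⟩
  have h1 : adj.homEquiv _ _ g = ∑ i ∈ s, a i ≫ R.map (Sigma.ι A i) := by
    rw [← cancel_mono (inv (sigmaComparison R A)), ha, Preadditive.sum_comp]
    refine Finset.sum_congr rfl fun i _ => ?_
    simp [map_ι_comp_inv_sigmaComparison]
  rw [← (adj.homEquiv _ _).symm_apply_apply g, h1, Adjunction.homEquiv_counit, L.map_sum,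
    Preadditive.sum_comp]
  refine Finset.sum_congr rfl fun i _ => ?_
  simp [Adjunction.homEquiv_counit]

lemma Sm.shift [HasShift C ℤ] [∀ n : ℤ, (shiftFunctor C n).Additive] {G : C} (h : Sm G)
    (n : ℤ) : Sm (G⟦n⟧) := by
  have : (shiftEquiv C n).functor.Additive := inferInstanceAs (shiftFunctor C n).Additive
  exact h.leftAdj (shiftEquiv C n).toAdjunction

end Small

section Telescope

variable {C : Type u} [Category.{v} C] [HasZeroObject C] [HasShift C ℤ] [Preadditive C]
    [∀ n : ℤ, (shiftFunctor C n).Additive] [Pretriangulated C] [HasCoproducts.{v} C]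

variable {S : C} {P : C → Prop}

lemma step (hshift : ∀ n : ℤ, P (S⟦n⟧))
    (hcop : ∀ (ι : Type v) (A : ι → C), (∀ i, P (A i)) → P (∐ A))
    (hcone : ∀ T ∈ distTriang C, P T.obj₁ → P T.obj₂ → P T.obj₃)
    (A : C) (X : C) (u : X ⟶ A) (hX : P X) :
    ∃ (X' : C) (u' : X' ⟶ A) (f : X ⟶ X'), P X' ∧ f ≫ u' = u ∧
      ∀ (n : ℤ) (a : S⟦n⟧ ⟶ X), a ≫ u = 0 → a ≫ f = 0 := by
  let J : Type v := Σ n : ℤ, {a : S⟦n⟧ ⟶ X // a ≫ u = 0}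
  let B : J → C := fun j => S⟦j.1⟧
  let d : ∐ B ⟶ X := Sigma.desc fun j => j.2.1
  obtain ⟨Z, f, h, hT⟩ := distinguished_cocone_triangle d
  have hdu : d ≫ u = 0 := by
    apply Sigma.hom_ext
    intro j
    simp [d, j.2.2]
  obtain ⟨u', hu'⟩ := Triangle.yoneda_exact₂ _ hT u hdu
  refine ⟨Z, u', f, hcone _ hT (hcop _ _ fun j => hshift _) hX, hu'.symm, ?_⟩
  intro n a ha
  have h0 : d ≫ f = 0 := comp_distTriang_mor_zero₁₂ _ hT
  have : a = Sigma.ι B ⟨n, a, ha⟩ ≫ d := by simp [d]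
  rw [this, assoc, h0, comp_zero]

/-- Objects over `A` which satisfy `P`. -/
structure Stage (P : C → Prop) (A : C) where
  X : C
  u : X ⟶ A
  hX : P X

/-- The inclusion of the `n`-th term. -/
noncomputable abbrev inc (X : ℕ → C) (n : ℕ) :
    X n ⟶ ∐ (fun i : ULift.{v} ℕ => X i.down) :=
  Sigma.ι (fun i : ULift.{v} ℕ => X i.down) ⟨n⟩

lemma telescope_inj (X : ℕ → C) (f : ∀ n, X n ⟶ X (n + 1)) {G : C} (hG : Sm G)
    (g : G ⟶ ∐ (fun i : ULift.{v} ℕ => X i.down))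
    (hg : g ≫ (𝟙 _ - Limits.Sigma.desc fun i : ULift.{v} ℕ => f i.down ≫ inc X (i.down + 1)) = 0) :
    g = 0 := by
  set sh : (∐ (fun i : ULift.{v} ℕ => X i.down)) ⟶ _ :=
    Limits.Sigma.desc fun i : ULift.{v} ℕ => f i.down ≫ inc X (i.down + 1) with hsh
  have hg' : g = g ≫ sh := by
    rwa [Preadditive.comp_sub, comp_id, sub_eq_zero] at hg
  have key : ∀ n : ℕ, g ≫ Sigma.π (fun i : ULift.{v} ℕ => X i.down) ⟨n⟩ = 0 := by
    intro n
    induction n with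
    | zero =>
      have : sh ≫ Sigma.π (fun i : ULift.{v} ℕ => X i.down) ⟨0⟩ = 0 := by
        apply Sigma.hom_ext
        intro i
        rw [hsh, Sigma.ι_desc_assoc, assoc, Sigma.ι_π_of_ne, comp_zero, comp_zero]
        intro h
        simpa using congrArg ULift.down h
      rw [hg', assoc, this, comp_zero]
    | succ n ih =>
      have : sh ≫ Sigma.π (fun i : ULift.{v} ℕ => X i.down) ⟨n + 1⟩ =
          Sigma.π (fun i : ULift.{v} ℕ => X i.down) ⟨n⟩ ≫ f n := by
        apply Sigma.hom_ext
        rintro ⟨i⟩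
        rw [hsh, Sigma.ι_desc_assoc, assoc]
        by_cases hi : i = n
        · subst hi
          rw [Sigma.ι_π_eq_id, comp_id, Sigma.ι_π_eq_id_assoc]
        · rw [Sigma.ι_π_of_ne, Sigma.ι_π_of_ne_assoc, comp_zero, zero_comp]
          · intro h; exact hi (congrArg ULift.down h)
          · intro h; exact hi (by simpa using congrArg ULift.down h)
      rw [hg', assoc, this, reassoc_of% ih, zero_comp]
  exact hG.eq_zero _ g fun i => key i.down

lemma generation (hS : Sm S) (hgen : IsWeakGenerator S)
    (hiso : ∀ X Y : C, (X ≅ Y) → P X → P Y)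
    (hshift : ∀ n : ℤ, P (S⟦n⟧))
    (hcop : ∀ (ι : Type v) (A : ι → C), (∀ i, P (A i)) → P (∐ A))
    (hcone : ∀ T ∈ distTriang C, P T.obj₁ → P T.obj₂ → P T.obj₃) (A : C) : P A := by
  choose X' u' f' hP' hfu' hz' using step (S := S) (P := P) hshift hcop hcone A
  let J : Type v := Σ n : ℤ, (S⟦n⟧ ⟶ A)
  let B : J → C := fun j => S⟦j.1⟧
  let st : ℕ → Stage P A := fun n => Nat.rec
    ⟨∐ B, Sigma.desc fun j => j.2, hcop _ _ fun j => hshift _⟩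
    (fun _ Y => ⟨X' Y.X Y.u Y.hX, u' Y.X Y.u Y.hX, hP' Y.X Y.u Y.hX⟩) n
  let X : ℕ → C := fun n => (st n).X
  let u : ∀ n, X n ⟶ A := fun n => (st n).u
  let f : ∀ n, X n ⟶ X (n + 1) := fun n => f' (st n).X (st n).u (st n).hX
  have hfu : ∀ n, f n ≫ u (n + 1) = u n := fun n => hfu' (st n).X (st n).u (st n).hX
  have hz : ∀ n (m : ℤ) (a : S⟦m⟧ ⟶ X n), a ≫ u n = 0 → a ≫ f n = 0 :=
    fun n m a ha => hz' (st n).X (st n).u (st n).hX m a ha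
  have hX : ∀ n, P (X n) := fun n => (st n).hX
  have hsurj : ∀ (m : ℤ) (a : S⟦m⟧ ⟶ A), ∃ b : S⟦m⟧ ⟶ X 0, b ≫ u 0 = a := fun m a =>
    ⟨Sigma.ι B ⟨m, a⟩, Sigma.ι_desc (f := B) (fun j => j.2) ⟨m, a⟩⟩
  clear_value f u X
  clear st
  let Y : C := ∐ (fun i : ULift.{v} ℕ => X i.down)
  let sh : Y ⟶ Y := Sigma.desc fun i : ULift.{v} ℕ => f i.down ≫ inc X (i.down + 1)
  have hY : P Y := hcop _ _ fun i => hX _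
  obtain ⟨Z, c, h, hT⟩ := distinguished_cocone_triangle (𝟙 Y - sh)
  have hZ : P Z := hcone _ hT hY hY
  have hι : ∀ n, inc X n ≫ sh = f n ≫ inc X (n + 1) := fun n => by simp [sh, inc]
  have hc : sh ≫ c = c := by
    have : (𝟙 Y - sh) ≫ c = 0 := comp_distTriang_mor_zero₁₂ _ hT
    rw [Preadditive.sub_comp, id_comp, sub_eq_zero] at this
    exact this.symm
  have hιc : ∀ n, f n ≫ inc X (n + 1) ≫ c = inc X n ≫ c := fun n => by
    rw [← assoc, ← hι, assoc, hc]
  let U : Y ⟶ A := Sigma.desc fun i : ULift.{v} ℕ => u i.down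
  have hιU : ∀ n, inc X n ≫ U = u n := fun n => by simp [U, inc]
  have hU : (𝟙 Y - sh) ≫ U = 0 := by
    rw [Preadditive.sub_comp, id_comp, sub_eq_zero]
    apply Sigma.hom_ext
    rintro ⟨n⟩
    rw [← assoc]
    change inc X n ≫ U = (inc X n ≫ sh) ≫ U
    rw [hι, assoc, hιU, hιU, hfu]
  obtain ⟨w, hw⟩ : ∃ w : Z ⟶ A, U = c ≫ w := Triangle.yoneda_exact₂ _ hT U hU
  replace hw : c ≫ w = U := hw.symm
  have hιcw : ∀ n, inc X n ≫ c ≫ w = u n := fun n => by rw [hw, hιU]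
  -- maps to the telescope lift to the coproduct
  have hlift : ∀ (m : ℤ) (a : S⟦m⟧ ⟶ Z), ∃ b : S⟦m⟧ ⟶ Y, a = b ≫ c := by
    intro m a
    refine Triangle.coyoneda_exact₃ _ hT a ?_
    change a ≫ h = 0
    let e : (S⟦m - 1⟧)⟦(1 : ℤ)⟧ ≅ S⟦m⟧ := (shiftFunctorAdd' C (m - 1) 1 m (by lia)).symm.app S
    obtain ⟨k, hk⟩ := (shiftFunctor C (1 : ℤ)).map_surjective (e.hom ≫ a ≫ h)
    have h0 : h ≫ (𝟙 Y - sh)⟦(1 : ℤ)⟧' = 0 := comp_distTriang_mor_zero₃₁ _ hT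
    have hk0 : k ≫ (𝟙 Y - sh) = 0 := by
      apply (shiftFunctor C (1 : ℤ)).map_injective
      rw [Functor.map_comp, hk, assoc, assoc, h0, comp_zero, comp_zero, Functor.map_zero]
    have : k = 0 := telescope_inj X f (hS.shift (m - 1)) k hk0
    rw [← cancel_epi e.hom, ← hk, this, Functor.map_zero, comp_zero]
  -- maps to the telescope come from some stage
  have hstage : ∀ (m : ℤ) (a : S⟦m⟧ ⟶ Z), ∃ n, ∃ b : S⟦m⟧ ⟶ X n, a = b ≫ inc X n ≫ c := by
    intro m a
    obtain ⟨b, rfl⟩ := hlift m a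
    obtain ⟨s, y, rfl⟩ := hS.shift m _ b
    suffices ∃ N, ∀ n ≥ N, ∃ b : S⟦m⟧ ⟶ X n,
        (∑ i ∈ s, y i ≫ Sigma.ι (fun i : ULift.{v} ℕ => X i.down) i) ≫ c = b ≫ inc X n ≫ c by
      obtain ⟨N, hN⟩ := this
      exact ⟨N, hN N le_rfl⟩
    classical
    induction s using Finset.induction_on with
    | empty => exact ⟨0, fun n _ => ⟨0, by simp⟩⟩
    | insert i s hi ih =>
      obtain ⟨N, hN⟩ := ih
      have h1 : ∀ n ≥ i.down, ∃ b : S⟦m⟧ ⟶ X n,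
          y i ≫ Sigma.ι (fun i : ULift.{v} ℕ => X i.down) i ≫ c = b ≫ inc X n ≫ c := by
        intro n hn
        induction n, hn using Nat.le_induction with
        | base => exact ⟨y i, rfl⟩
        | succ n hn ih =>
          obtain ⟨b, hb⟩ := ih
          exact ⟨b ≫ f n, by rw [hb, assoc, hιc]⟩
      refine ⟨max N i.down, fun n hn => ?_⟩
      obtain ⟨b, hb⟩ := hN n (le_trans (le_max_left _ _) hn)
      obtain ⟨b', hb'⟩ := h1 n (le_trans (le_max_right _ _) hn)
      refine ⟨b' + b, ?_⟩
      rw [Finset.sum_insert hi, Preadditive.add_comp, assoc, hb, hb', Preadditive.add_comp]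
  have hw_iso : IsIso w := by
    rw [hgen w]
    intro m
    constructor
    · intro a₁ a₂ h12
      rw [← sub_eq_zero]
      have h0 : (a₁ - a₂) ≫ w = 0 := by
        rw [Preadditive.sub_comp, sub_eq_zero]; exact h12
      obtain ⟨n, b, hb⟩ := hstage m (a₁ - a₂)
      rw [hb, assoc, assoc, hιcw] at h0
      rw [hb, ← hιc, reassoc_of% (hz n m b h0), zero_comp]
    · intro a
      obtain ⟨b, hb⟩ := hsurj m a
      refine ⟨b ≫ inc X 0 ≫ c, ?_⟩
      change (b ≫ inc X 0 ≫ c) ≫ w = a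
      rw [assoc, assoc, hιcw, hb]
  exact hiso Z A (asIso w) hZ

end Telescope

end Paper

theorem statement_5
    {C : Type u} [Category.{v} C] [HasZeroObject C] [HasShift C ℤ] [Preadditive C]
    [∀ n : ℤ, (shiftFunctor C n).Additive] [Pretriangulated C] [HasCoproducts.{v} C]
    {D : Type u} [Category.{v} D] [HasZeroObject D] [HasShift D ℤ] [Preadditive D]
    [∀ n : ℤ, (shiftFunctor D n).Additive] [Pretriangulated D] [HasCoproducts.{v} D]
    (F : C ⥤ D) [F.Additive] [F.CommShift ℤ] [F.IsTriangulated]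
    (G : D ⥤ C) [G.Additive] [G.CommShift ℤ] [G.IsTriangulated]
    (adj : F ⊣ G)
    -- the adjunction is compatible with the shifts:
    [NatTrans.CommShift adj.unit ℤ] [NatTrans.CommShift adj.counit ℤ]
    (S : C) (hS_small : IsSmallObject S) (hS_gen : IsWeakGenerator S)
    (hFS_small : IsSmallObject (F.obj S)) (hFS_gen : IsWeakGenerator (F.obj S))
    (hunit_S : IsIso (adj.unit.app S)) :
    (∀ A : C, IsIso (adj.unit.app A)) ∧ (∀ B : D, IsIso (adj.counit.app B)) := by
  classical
  have hFSn : ∀ n : ℤ, Sm (F.obj (S⟦n⟧)) := fun n =>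
    (hFS_small.sm.shift n).of_iso ((F.commShiftIso n).app S).symm
  -- `G` preserves coproducts
  have hcmp : ∀ (ι : Type v) (A : ι → D), IsIso (sigmaComparison G A) := by
    intro ι A
    rw [hS_gen]
    intro n
    constructor
    · intro a₁ a₂ h12
      rw [← sub_eq_zero]
      apply (hS_small.sm.shift n).eq_zero
      intro i
      have h0 : (a₁ - a₂) ≫ sigmaComparison G A = 0 := by
        rw [Preadditive.sub_comp, sub_eq_zero]; exact h12
      have h1 : sigmaComparison G A ≫ G.map (Sigma.π A i) = Sigma.π (fun b => G.obj (A b)) i := by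
        apply Sigma.hom_ext
        intro j
        rw [ι_comp_sigmaComparison_assoc, ← G.map_comp]
        by_cases hj : j = i
        · subst hj
          rw [Sigma.ι_π_eq_id, Sigma.ι_π_eq_id, G.map_id]
        · rw [Sigma.ι_π_of_ne _ hj, Sigma.ι_π_of_ne _ hj, G.map_zero]
      rw [← h1, reassoc_of% h0, zero_comp]
    · intro g
      obtain ⟨s, a, ha⟩ := hFSn n A ((adj.homEquiv _ _).symm g)
      refine ⟨∑ i ∈ s, adj.homEquiv _ _ (a i) ≫ Sigma.ι (fun b => G.obj (A b)) i, ?_⟩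
      change (∑ i ∈ s, adj.homEquiv _ _ (a i) ≫ Sigma.ι (fun b => G.obj (A b)) i) ≫
        sigmaComparison G A = g
      rw [← (adj.homEquiv _ _).apply_symm_apply g, ha, Adjunction.homEquiv_unit, G.map_sum,
        Preadditive.comp_sum, Preadditive.sum_comp]
      refine Finset.sum_congr rfl fun i _ => ?_
      simp [Adjunction.homEquiv_unit]
  have hunit : ∀ A : C, IsIso (adj.unit.app A) := by
    have hshift : ∀ n : ℤ, IsIso (adj.unit.app (S⟦n⟧)) := by
      intro n
      have := NatTrans.app_shift adj.unit n S
      rw [this]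
      infer_instance
    refine generation (S := S) (P := fun A => IsIso (adj.unit.app A)) hS_small.sm hS_gen
      ?_ hshift ?_ ?_
    · intro X Y e hX
      exact (NatTrans.isIso_app_iff_of_iso adj.unit e).1 hX
    · intro ι A hA
      have := hcmp ι (fun i => F.obj (A i))
      have : PreservesColimitsOfSize.{v, v} F := adj.leftAdjoint_preservesColimits
      have e : adj.unit.app (∐ A) =
          Limits.Sigma.map (fun i => adj.unit.app (A i)) ≫
            sigmaComparison G (fun i => F.obj (A i)) ≫ G.map (sigmaComparison F A) := by
        apply Sigma.hom_ext
        intro i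
        have := adj.unit.naturality (Sigma.ι A i)
        dsimp at this ⊢
        rw [this, Limits.Sigma.ι_map_assoc, ι_comp_sigmaComparison_assoc, ← G.map_comp,
          ι_comp_sigmaComparison]
      rw [e]
      infer_instance
    · intro T hT h₁ h₂
      have hT' := (F ⋙ G).map_distinguished T hT
      let φ : T ⟶ (F ⋙ G).mapTriangle.obj T :=
        { hom₁ := adj.unit.app T.obj₁
          hom₂ := adj.unit.app T.obj₂
          hom₃ := adj.unit.app T.obj₃
          comm₁ := adj.unit.naturality T.mor₁
          comm₂ := adj.unit.naturality T.mor₂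
          comm₃ := by
            have h1 := adj.unit.naturality T.mor₃
            have h2 := NatTrans.shift_app_comm adj.unit (1 : ℤ) T.obj₁
            simp only [Functor.commShiftIso_id_hom_app, Functor.id_obj,
              Functor.id_map] at h1 h2
            erw [id_comp] at h2
            have h3 : T.mor₃ ≫ (shiftFunctor C (1 : ℤ)).map (adj.unit.app T.obj₁) =
                adj.unit.app T.obj₃ ≫ (F ⋙ G).map T.mor₃ ≫
                  ((F ⋙ G).commShiftIso (1 : ℤ)).hom.app T.obj₁ := by
              rw [h2, reassoc_of% h1]
              rfl
            exact h3 }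
      exact isIso₃_of_isIso₁₂ φ hT hT' h₁ h₂
  refine ⟨hunit, fun B => ?_⟩
  have hG : IsIso (G.map (adj.counit.app B)) := by
    have := hunit (G.obj B)
    exact IsIso.of_isIso_fac_left (adj.right_triangle_components B)
  rw [hFS_gen]
  intro n
  let e := (F.commShiftIso n).app S
  constructor
  · intro a₁ a₂ h12
    rw [← cancel_epi e.hom]
    apply (adj.homEquiv _ _).injective
    rw [← cancel_mono (G.map (adj.counit.app B)), ← Adjunction.homEquiv_naturality_right,
      ← Adjunction.homEquiv_naturality_right, assoc, assoc]
    congr 2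
  · intro g
    refine ⟨e.inv ≫ (adj.homEquiv _ _).symm
      (adj.homEquiv _ _ (e.hom ≫ g) ≫ inv (G.map (adj.counit.app B))), ?_⟩
    change (e.inv ≫ (adj.homEquiv _ _).symm
      (adj.homEquiv _ _ (e.hom ≫ g) ≫ inv (G.map (adj.counit.app B)))) ≫ _ = g
    rw [assoc, ← Adjunction.homEquiv_naturality_right_symm, assoc, IsIso.inv_hom_id, comp_id,
      Equiv.symm_apply_apply, Iso.inv_hom_id_assoc]
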